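/- Let I be a workflow instance with constraint graph G and let (T, X) be a rooted tree decomposition of the Hasse diagram D of (U, <). Let i be a forget node with bag B = {u_1, …, u_{p−1}} whose unique child has bag B' = {u_1, …, u_p} = B ∪ {u_p}, u_p ∉ B. Let T' ⊆ S and R : T' → B ∪ {[<],[>],[∼]}^{p−1}. Then a (B, T', R)-plan exists if and only if there exists a function R' : T' → B' ∪ {[<],[>],[∼]}^{p} such that a (B', T', R')-plan exists, where R' satisfies: (i) R'(x) = R(x) whenever R(x) ∈ B; (ii) for each x with R(x) ∉ B, writing R(x) = (x_{u_1}, …, x_{u_{p−1}}), either R'(x) = u_p, which is allowed only if R(x) = R(u_p, B), or R'(x) = (x_{u_1}, …, x_{u_{p−1}}, α) for some α ∈ {[<],[>],[∼]}. -/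

import Mathlib

/-- The three symbols `[<]`, `[>]`, `[∼]`. -/
inductive Rel3 : Type where
  | lt : Rel3
  | gt : Rel3
  | sim : Rel3
deriving DecidableEq

open Classical in
/-- The relation `φ(v, u)` of a user `v` to a user `u`: `[<]` if `v < u`, `[>]` if
`u < v`, and `[∼]` otherwise. -/
noncomputable def phi {U : Type*} [PartialOrder U] (v u : U) : Rel3 :=
  if v < u then Rel3.lt else if u < v then Rel3.gt else Rel3.sim

/-- `j` is a descendant of `i` in the tree `T` rooted at `r`: `j ≠ i` and `i` lies on
the (unique) path in `T` from the root `r` to `j`. -/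
def IsDesc {ι : Type*} (T : SimpleGraph ι) (r i j : ι) : Prop :=
  j ≠ i ∧ ∀ p : T.Walk r j, p.IsPath → i ∈ p.support

/-- The set of users lying in the bag of node `i` or in the bag of a descendant of `i`
(in the tree `T` with bags `Bags`, rooted at `r`). -/
def allowedUsers {ι U : Type*} (T : SimpleGraph ι) (r : ι) (Bags : ι → Set U) (i : ι) :
    Set U :=
  Bags i ∪ ⋃ j ∈ {j | IsDesc T r i j}, Bags j

/-- A `(B, T', R)`-plan for the workflow instance with authorization lists `L`,
separation-of-duty constraints `Gne` (the undirected edges of the constraint graph),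
seniority constraints `Glt` (the arcs of the constraint graph), bag `Bag`, and set
`Allowed` of users lying in `Bag` or in the bag of a descendant node.  Here the values
of `R` and `π` are relevant only on the set `T'` of steps; tuples over the bag are
represented as functions `↥Bag → Rel3`. -/
def IsBTRPlan {S U : Type*} [PartialOrder U]
    (L : S → Set U) (Gne Glt : S → S → Prop)
    (Bag Allowed : Set U) (T' : Set S)
    (R : S → ↥Bag ⊕ (↥Bag → Rel3)) (π : S → U) : Prop :=
  (∀ x ∈ T', π x ∈ L x) ∧
  (∀ x ∈ T', ∀ y ∈ T', Gne x y → π x ≠ π y) ∧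
  (∀ x ∈ T', ∀ y ∈ T', Glt x y → π x < π y) ∧
  (∀ x ∈ T', π x ∈ Allowed) ∧
  (∀ x ∈ T', ∀ u : ↥Bag, (π x = ↑u ↔ R x = Sum.inl u)) ∧
  (∀ x ∈ T', ∀ f : ↥Bag → Rel3, R x = Sum.inr f → ∀ u : ↥Bag, phi (π x) ↑u = f u)

/-- On a tree, a proper descendant of `i` is the unique child `i'` of `i` or a descendant of it. -/
theorem IsDesc.eq_or_isDesc_of_unique_child {ι : Type*} {T : SimpleGraph ι} {r i i' j : ι}
    (hT : T.IsTree) (huniq : ∀ k, T.Adj i k → IsDesc T r i k → k = i')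
    (h : IsDesc T r i j) : j = i' ∨ IsDesc T r i' j := by
  classical
  refine or_iff_not_imp_left.2 fun hji => ⟨hji, fun p hp => ?_⟩
  have hi := h.2 p hp
  have hspec := p.take_spec hi
  generalize p.takeUntil i hi = t at hspec
  generalize p.dropUntil i hi = d at hspec
  subst hspec
  cases d with
  | nil => exact absurd rfl h.1
  | @cons _ k _ hadj d =>
    have hc : (t.concat hadj).IsPath := by
      rw [← SimpleGraph.Walk.concat_append] at hp
      exact hp.of_append_left
    have hk : IsDesc T r i k := by
      refine ⟨hadj.ne', fun q hq => ?_⟩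
      have hqe : q = t.concat hadj :=
        congrArg Subtype.val ((hT.isAcyclic.subsingleton_path r k).elim ⟨q, hq⟩ ⟨_, hc⟩)
      simp [hqe, SimpleGraph.Walk.support_concat]
    rw [← huniq k hadj hk]
    simp [SimpleGraph.Walk.mem_support_append_iff]

theorem IsDesc.mem_support_trans {ι : Type*} {T : SimpleGraph ι} {r i k j : ι}
    (hik : IsDesc T r i k) (hkj : IsDesc T r k j) (p : T.Walk r j) (hp : p.IsPath) :
    i ∈ p.support := by
  classical
  have hk := hkj.2 p hp
  exact p.support_takeUntil_subset_support hk (hik.2 _ (hp.takeUntil hk))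

/-- Passing from a node to its unique child with a larger bag keeps the users at or below it. -/
theorem allowedUsers_eq_of_unique_child {ι U : Type*} {T : SimpleGraph ι} {r i i' : ι}
    {Bags : ι → Set U} (hT : T.IsTree) (hdesc : IsDesc T r i i')
    (huniq : ∀ k, T.Adj i k → IsDesc T r i k → k = i') (hsub : Bags i ⊆ Bags i') :
    allowedUsers T r Bags i = allowedUsers T r Bags i' := by
  ext u
  simp only [allowedUsers, Set.mem_union, Set.mem_iUnion, Set.mem_ofPred_eq, exists_prop]
  constructor
  · rintro (h | ⟨j, hj, hu⟩)
    · exact Or.inl (hsub h)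
    · rcases hj.eq_or_isDesc_of_unique_child hT huniq with rfl | hj'
      · exact Or.inl hu
      · exact Or.inr ⟨j, hj', hu⟩
  · rintro (h | ⟨j, hj, hu⟩)
    · exact Or.inr ⟨i', hdesc, h⟩
    · by_cases hji : j = i
      · exact Or.inl (hji ▸ hu)
      · exact Or.inr ⟨j, ⟨hji, hdesc.mem_support_trans hj⟩, hu⟩

/-- Forget node.  Let `(T, Bags)` be a rooted tree decomposition of the Hasse diagram of
`(U, <)` and let `i` be a forget node with bag `B = Bags i` whose unique child `i'` has
bag `B' = Bags i' = B ∪ {up}` with `up ∉ B`.  Let `T' ⊆ S` and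
`R : S → B ⊕ (B → Rel3)`.  Then a `(B, T', R)`-plan exists iff there is a function
`R' : S → B' ⊕ (B' → Rel3)` admitting a `(B', T', R')`-plan and satisfying, for every
`x ∈ T'`: (i) `R' x = R x` whenever `R x ∈ B`; (ii) if `R x ∉ B` then either
`R' x = up`, which is allowed only if `R x = 𝓡(up, B)` (the tuple of relations of `up`
to `B`), or `R' x` is a tuple extending the tuple `R x` by one coordinate at `up`. -/
theorem stmt_8 {S U ι : Type*} [Fintype S] [Fintype U] [Fintype ι] [PartialOrder U]
    (L : S → Set U) (Gne Glt : S → S → Prop)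
    (hGneSymm : ∀ x y, Gne x y → Gne y x)
    (hGneIrr : ∀ x, ¬ Gne x x) (hGltIrr : ∀ x, ¬ Glt x x)
    (T : SimpleGraph ι) (Bags : ι → Set U) (root : ι)
    (hTree : T.IsTree)
    (hcov : ∀ u : U, ∃ i, u ∈ Bags i)
    (harc : ∀ u v : U, u ⋖ v → ∃ i, u ∈ Bags i ∧ v ∈ Bags i)
    (hconn : ∀ u : U, (T.induce {i | u ∈ Bags i}).Connected)
    (i i' : ι) (up : U)
    (hadj : T.Adj i i') (hdesc : IsDesc T root i i')
    (huniq : ∀ j, T.Adj i j → IsDesc T root i j → j = i')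
    (hup : up ∉ Bags i) (hupmem : up ∈ Bags i')
    (hsub : Bags i ⊆ Bags i') (hB' : Bags i' = insert up (Bags i))
    (T' : Set S) (R : S → ↥(Bags i) ⊕ (↥(Bags i) → Rel3)) :
    (∃ π : S → U,
        IsBTRPlan L Gne Glt (Bags i) (allowedUsers T root Bags i) T' R π) ↔
      ∃ R' : S → ↥(Bags i') ⊕ (↥(Bags i') → Rel3),
        (∀ x ∈ T',
          (∀ u : ↥(Bags i), R x = Sum.inl u →
            R' x = Sum.inl (Set.inclusion hsub u)) ∧
          (∀ f : ↥(Bags i) → Rel3, R x = Sum.inr f →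
            (R' x = Sum.inl ⟨up, hupmem⟩ ∧ ∀ w : ↥(Bags i), f w = phi up ↑w) ∨
            (∃ g : ↥(Bags i') → Rel3, R' x = Sum.inr g ∧
              ∀ w : ↥(Bags i), g (Set.inclusion hsub w) = f w))) ∧
        ∃ π : S → U,
          IsBTRPlan L Gne Glt (Bags i') (allowedUsers T root Bags i') T' R' π := by
  classical
  rw [← allowedUsers_eq_of_unique_child hTree hdesc huniq hsub]
  constructor
  · rintro ⟨π, hL, hne, hlt, hall, hin, hrel⟩
    refine ⟨fun x => if h : π x ∈ Bags i' then Sum.inl ⟨π x, h⟩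
      else Sum.inr fun u => phi (π x) u, fun x hx => ⟨fun u hu => ?_, fun f hf => ?_⟩,
      π, hL, hne, hlt, hall, fun x hx u => ?_, fun x hx f hf u => ?_⟩
    · have hπ := (hin x hx u).2 hu
      have hmem : π x ∈ Bags i' := hπ ▸ hsub u.2
      exact (dif_pos hmem).trans <| congrArg Sum.inl (Subtype.ext hπ)
    · by_cases hmem : π x ∈ Bags i'
      · left
        have hπ : π x = up := by
          rw [hB'] at hmem
          refine hmem.resolve_right fun hB => ?_
          have := (hin x hx ⟨π x, hB⟩).1 rfl
          simp [hf] at this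
        refine ⟨?_, fun w => ?_⟩
        · exact (dif_pos hmem).trans <| congrArg Sum.inl (Subtype.ext hπ)
        · rw [← hπ, hrel x hx f hf w]
      · right
        exact ⟨_, dif_neg hmem, fun w => hrel x hx f hf w⟩
    · by_cases hmem : π x ∈ Bags i'
      · simp [hmem, Subtype.ext_iff]
      · have : π x ≠ u := fun h => hmem (h ▸ u.2)
        simp [hmem, this]
    · by_cases hmem : π x ∈ Bags i'
      · simp [hmem] at hf
      · simp only [hmem, dite_false, Sum.inr.injEq] at hf
        exact congrFun hf u
  · rintro ⟨R', hR', π, hL, hne, hlt, hall, hin, hrel⟩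
    refine ⟨π, hL, hne, hlt, hall, fun x hx u => ⟨fun hπ => ?_, fun hu => ?_⟩,
      fun x hx f hf u => ?_⟩
    · have hu := (hin x hx (Set.inclusion hsub u)).1 hπ
      rcases hRx : R x with v | f
      · have hv := (hin x hx _).2 ((hR' x hx).1 v hRx)
        exact congrArg Sum.inl (Subtype.ext (hv.symm.trans hπ))
      · rcases (hR' x hx).2 f hRx with ⟨h, -⟩ | ⟨g, h, -⟩
        · have hπup : π x = up := (hin x hx _).2 h
          exact absurd (hπup.symm.trans hπ ▸ u.2) hup
        · simp [hu] at h
    · exact (hin x hx _).2 ((hR' x hx).1 u hu)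
    · rcases (hR' x hx).2 f hf with ⟨h, hw⟩ | ⟨g, h, hw⟩
      · have hπ : π x = up := (hin x hx _).2 h
        rw [hπ, hw u]
      · rw [← hw u]
        exact hrel x hx g h (Set.inclusion hsub u)
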